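/- arXiv:1907.00019 — 12 statements merged into one kernel-verified Lean document; each statement's English description precedes it below -/
import Mathlib

section
/- Let V be any type and let L₁, L₂, L₃ : V → ℂ → ℂ → Matrix (Fin 2) (Fin 2) ℂ be families of matrices L_i(x; a, λ) depending on x ∈ V, a parameter a ∈ ℂ and a spectral parameter λ ∈ ℂ. Suppose S, R, T : ℂ → ℂ → V × V → V × V are maps such that for all parameters a, b and all x, y ∈ V and all λ: L₁(S₁(x,y); a, λ)·L₂(S₂(x,y); b, λ) = L₂(y; b, λ)·L₁(x; a, λ), L₁(R₁(x,y); a, λ)·L₃(R₂(x,y); b, λ) = L₃(y; b, λ)·L₁(x; a, λ), and L₂(T₁(x,y); a, λ)·L₃(T₂(x,y); b, λ) = L₃(y; b, λ)·L₂(x; a, λ), where S(x,y) = (S₁(x,y), S₂(x,y)) etc. (parameter arguments of S,R,T suppressed). Suppose moreover that for all parameters a, b, c, the trifactorisation is injective: if L₁(x; a, λ)·L₂(y; b, λ)·L₃(z; c, λ) = L₁(x'; a, λ)·L₂(y'; b, λ)·L₃(z'; c, λ) for all λ, then x = x', y = y', z = z'. Then the parametric entwining Yang-Baxter equation holds: S¹²_{a,b}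 ∘ R¹³_{a,c} ∘ T²³_{b,c} = T²³_{b,c} ∘ R¹³_{a,c} ∘ S¹²_{a,b} as maps on V × V × V, for all a, b, c. -/
/-- Action of a map on components 1,2 of a triple. -/
def ent12 {V : Type*} (F : V × V → V × V) : V × V × V → V × V × V :=
  fun p => ((F (p.1, p.2.1)).1, (F (p.1, p.2.1)).2, p.2.2)

/-- Action of a map on components 1,3 of a triple. -/
def ent13 {V : Type*} (F : V × V → V × V) : V × V × V → V × V × V :=
  fun p => ((F (p.1, p.2.2)).1, p.2.1, (F (p.1, p.2.2)).2)

/-- Action of a map on components 2,3 of a triple. -/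
def ent23 {V : Type*} (F : V × V → V × V) : V × V × V → V × V × V :=
  fun p => (p.1, (F (p.2.1, p.2.2)).1, (F (p.2.1, p.2.2)).2)

/-- If (S,R,T) admit the Lax refactorisation identities with the triple (L₁,L₂,L₃)
and the trifactorisation is injective, then (S,R,T) satisfies the parametric
entwining Yang-Baxter equation. -/
theorem stmt0 {V : Type*}
    (L₁ L₂ L₃ : V → ℂ → ℂ → Matrix (Fin 2) (Fin 2) ℂ)
    (S R T : ℂ → ℂ → V × V → V × V)
    (hS : ∀ (a b : ℂ) (x y : V) (lam : ℂ),
      L₁ ((S a b (x, y)).1) a lam * L₂ ((S a b (x, y)).2) b lam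
        = L₂ y b lam * L₁ x a lam)
    (hR : ∀ (a b : ℂ) (x y : V) (lam : ℂ),
      L₁ ((R a b (x, y)).1) a lam * L₃ ((R a b (x, y)).2) b lam
        = L₃ y b lam * L₁ x a lam)
    (hT : ∀ (a b : ℂ) (x y : V) (lam : ℂ),
      L₂ ((T a b (x, y)).1) a lam * L₃ ((T a b (x, y)).2) b lam
        = L₃ y b lam * L₂ x a lam)
    (hinj : ∀ (a b c : ℂ) (x x' y y' z z' : V),
      (∀ lam : ℂ, L₁ x a lam * L₂ y b lam * L₃ z c lam
        = L₁ x' a lam * L₂ y' b lam * L₃ z' c lam) → x = x' ∧ y = y' ∧ z = z') :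
    ∀ a b c : ℂ,
      ent12 (S a b) ∘ ent13 (R a c) ∘ ent23 (T b c)
        = ent23 (T b c) ∘ ent13 (R a c) ∘ ent12 (S a b) := by
  intro a b c
  funext ⟨x, y, z⟩
  simp only [Function.comp_apply, ent12, ent13, ent23]
  rw [Prod.mk.injEq, Prod.mk.injEq]
  refine hinj a b c _ _ _ _ _ _ fun lam => ?_
  rw [hS, mul_assoc, hR, ← mul_assoc, hT, mul_assoc, ← hS]
  rw [mul_assoc (L₁ _ a lam), hT, ← mul_assoc (L₁ _ a lam), hR, mul_assoc]
end

section
/- Let Y be the map defined on points (x₁,x₂,y₁,y₂) ∈ ℂ⁴ with x₁ ≠ y₂ and x₂ ≠ y₁ by Y(x₁,x₂,y₁,y₂) = (u₁,u₂,v₁,v₂) where u₁ = x₁(y₁−x₂)/(x₁−y₂), u₂ = x₂(y₂−x₁)/(x₂−y₁), v₁ = y₁(y₂−x₁)/(x₂−y₁), v₂ = y₂(y₁−x₂)/(x₁−y₂). For 𝐱 = (x₁,x₂) ∈ ℂ² and λ ∈ ℂ with λ ≠ 1 and λ ≠ −1, define M(𝐱)(λ) = (1/(λ−1))·[[x₂,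 1],[1, −x₁]] − (1/(λ+1))·[[x₂, −1],[−1, −x₁]] ∈ Matrix (Fin 2) (Fin 2) ℂ. Then Y satisfies the Lax equation: for all (x₁,x₂,y₁,y₂) with x₁ ≠ y₂ and x₂ ≠ y₁ and all λ ∉ {1,−1}, M(u₁,u₂)(λ)·M(v₁,v₂)(λ) = M(y₁,y₂)(λ)·M(x₁,x₂)(λ), where (u₁,u₂,v₁,v₂) = Y(x₁,x₂,y₁,y₂). -/
/-- Darboux matrix for DNLS, ℤ₂ reduction group, generic orbits. -/
noncomputable def Mgen (x : ℂ × ℂ) (lam : ℂ) : Matrix (Fin 2) (Fin 2) ℂ :=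
  (1 / (lam - 1)) • !![x.2, 1; 1, -x.1] - (1 / (lam + 1)) • !![x.2, -1; -1, -x.1]

theorem Mgen_eq_smul (a b : ℂ) {lam : ℂ} (h1 : lam ≠ 1) (h2 : lam ≠ -1) :
    Mgen (a, b) lam = (2 / ((lam - 1) * (lam + 1))) • !![b, lam; lam, -a] := by
  have hsub : lam - 1 ≠ 0 := sub_ne_zero.mpr h1
  have hadd : lam + 1 ≠ 0 := fun h => h2 (eq_neg_of_add_eq_zero_left h)
  ext i j
  fin_cases i <;> fin_cases j <;> simp [Mgen] <;> field_simp <;> ring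

/-- The map Y satisfies the Lax equation M(u)M(v) = M(y)M(x). -/
theorem stmt2 (x₁ x₂ y₁ y₂ lam : ℂ)
    (hx : x₁ ≠ y₂) (hy : x₂ ≠ y₁) (h1 : lam ≠ 1) (h2 : lam ≠ -1) :
    Mgen (x₁ * (y₁ - x₂) / (x₁ - y₂), x₂ * (y₂ - x₁) / (x₂ - y₁)) lam *
      Mgen (y₁ * (y₂ - x₁) / (x₂ - y₁), y₂ * (y₁ - x₂) / (x₁ - y₂)) lam =
    Mgen (y₁, y₂) lam * Mgen (x₁, x₂) lam := by
  have hx' : x₁ - y₂ ≠ 0 := sub_ne_zero.mpr hx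
  have hy' : x₂ - y₁ ≠ 0 := sub_ne_zero.mpr hy
  simp only [Mgen_eq_smul _ _ h1 h2, Matrix.smul_mul, Matrix.mul_smul]
  congr 2
  ext i j
  fin_cases i <;> fin_cases j <;> simp [Matrix.mul_apply, Fin.sum_univ_two] <;>
    field_simp <;> ring
end

section
/- Let Y be the map on pairs of points of ℂ², Y((x₁,x₂),(y₁,y₂)) = ((u₁,u₂),(v₁,v₂)) with u₁ = x₁(y₁−x₂)/(x₁−y₂), u₂ = x₂(y₂−x₁)/(x₂−y₁), v₁ = y₁(y₂−x₁)/(x₂−y₁), v₂ = y₂(y₁−x₂)/(x₁−y₂), defined when x₁ ≠ y₂ and x₂ ≠ y₁. Then Y satisfies the set-theoretical Yang-Baxter equation: Y¹² ∘ Y¹³ ∘ Y²³ (x,y,z) = Y²³ ∘ Y¹³ ∘ Y¹² (x,y,z) for every triple (x,y,z) ∈ ℂ² × ℂ² × ℂ² at which every application of Y occurring in these compositions has nonvanishing denominators (i.e. both sides are defined). -/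
/-- The Yang-Baxter map derived from Darboux matrices of DNLS (generic orbits). -/
noncomputable def Ymap (p q : ℂ × ℂ) : (ℂ × ℂ) × (ℂ × ℂ) :=
  ((p.1 * (q.1 - p.2) / (p.1 - q.2), p.2 * (q.2 - p.1) / (p.2 - q.1)),
   (q.1 * (q.2 - p.1) / (p.2 - q.1), q.2 * (q.1 - p.2) / (p.1 - q.2)))

/-- Domain of definition of `Ymap`: nonvanishing denominators. -/
def Ydom (p q : ℂ × ℂ) : Prop := p.1 ≠ q.2 ∧ p.2 ≠ q.1

/-- `Ymap` acting on components 1,2 of a triple. -/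
noncomputable def Y12 (t : (ℂ × ℂ) × (ℂ × ℂ) × (ℂ × ℂ)) : (ℂ × ℂ) × (ℂ × ℂ) × (ℂ × ℂ) :=
  ((Ymap t.1 t.2.1).1, (Ymap t.1 t.2.1).2, t.2.2)

/-- `Ymap` acting on components 1,3 of a triple. -/
noncomputable def Y13 (t : (ℂ × ℂ) × (ℂ × ℂ) × (ℂ × ℂ)) : (ℂ × ℂ) × (ℂ × ℂ) × (ℂ × ℂ) :=
  ((Ymap t.1 t.2.2).1, t.2.1, (Ymap t.1 t.2.2).2)

/-- `Ymap` acting on components 2,3 of a triple. -/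
noncomputable def Y23 (t : (ℂ × ℂ) × (ℂ × ℂ) × (ℂ × ℂ)) : (ℂ × ℂ) × (ℂ × ℂ) × (ℂ × ℂ) :=
  (t.1, (Ymap t.2.1 t.2.2).1, (Ymap t.2.1 t.2.2).2)

/-- The coordinates of `Y12 ∘ Y13 ∘ Y23` and `Y23 ∘ Y13 ∘ Y12` that are exchanged
by swapping the two components of every point. -/
theorem yangBaxter_coordinates {x₁ x₂ y₁ y₂ z₁ z₂ b₁ b₂ c₁ c₂ a₁ a₂ p₁ p₂ q₁ q₂ r₁ r₂ : ℂ}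
    (hb₁ : b₁ = y₁ * (z₁ - y₂) / (y₁ - z₂)) (hb₂ : b₂ = y₂ * (z₂ - y₁) / (y₂ - z₁))
    (hc₁ : c₁ = z₁ * (z₂ - y₁) / (y₂ - z₁)) (hc₂ : c₂ = z₂ * (z₁ - y₂) / (y₁ - z₂))
    (ha₁ : a₁ = x₁ * (c₁ - x₂) / (x₁ - c₂)) (ha₂ : a₂ = x₂ * (c₂ - x₁) / (x₂ - c₁))
    (hp₁ : p₁ = x₁ * (y₁ - x₂) / (x₁ - y₂)) (hp₂ : p₂ = x₂ * (y₂ - x₁) / (x₂ - y₁))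
    (hq₁ : q₁ = y₁ * (y₂ - x₁) / (x₂ - y₁)) (hq₂ : q₂ = y₂ * (y₁ - x₂) / (x₁ - y₂))
    (hr₁ : r₁ = z₁ * (z₂ - p₁) / (p₂ - z₁)) (hr₂ : r₂ = z₂ * (z₁ - p₂) / (p₁ - z₂))
    (hyz₁ : y₁ - z₂ ≠ 0) (hyz₂ : y₂ - z₁ ≠ 0) (hxc₁ : x₁ - c₂ ≠ 0) (hxc₂ : x₂ - c₁ ≠ 0)
    (hxy₁ : x₁ - y₂ ≠ 0) (hxy₂ : x₂ - y₁ ≠ 0) (hpz₁ : p₁ - z₂ ≠ 0) (hpz₂ : p₂ - z₁ ≠ 0) :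
    a₁ * (b₁ - a₂) / (a₁ - b₂) = p₁ * (z₁ - p₂) / (p₁ - z₂) ∧
    b₁ * (b₂ - a₁) / (a₂ - b₁) = q₁ * (r₁ - q₂) / (q₁ - r₂) ∧
    c₁ * (c₂ - x₁) / (x₂ - c₁) = r₁ * (r₂ - q₁) / (q₂ - r₁) := by
  obtain ⟨P₁, hP₁⟩ : ∃ P, P = x₁ * (y₁ - z₂) - z₂ * (z₁ - y₂) := ⟨_, rfl⟩
  obtain ⟨P₂, hP₂⟩ : ∃ P, P = x₂ * (y₂ - z₁) - z₁ * (z₂ - y₁) := ⟨_, rfl⟩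
  obtain ⟨R₁, hR₁⟩ : ∃ R, R = x₁ * (y₁ - x₂) - z₂ * (x₁ - y₂) := ⟨_, rfl⟩
  obtain ⟨R₂, hR₂⟩ : ∃ R, R = x₂ * (y₂ - x₁) - z₁ * (x₂ - y₁) := ⟨_, rfl⟩
  have exc₁ : x₁ - c₂ = P₁ / (y₁ - z₂) := by rw [hc₂, hP₁]; field_simp
  have exc₂ : x₂ - c₁ = P₂ / (y₂ - z₁) := by rw [hc₁, hP₂]; field_simp
  have epz₁ : p₁ - z₂ = R₁ / (x₁ - y₂) := by rw [hp₁, hR₁]; field_simp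
  have epz₂ : p₂ - z₁ = R₂ / (x₂ - y₁) := by rw [hp₂, hR₂]; field_simp
  have P₁0 : P₁ ≠ 0 := by rintro rfl; simp [exc₁] at hxc₁
  have P₂0 : P₂ ≠ 0 := by rintro rfl; simp [exc₂] at hxc₂
  have R₁0 : R₁ ≠ 0 := by rintro rfl; simp [epz₁] at hpz₁
  have R₂0 : R₂ ≠ 0 := by rintro rfl; simp [epz₂] at hpz₂
  have eab₁ : a₁ - b₂ = (y₁ - z₂) * R₁ / P₁ := by
    rw [ha₁, hb₂, ← neg_sub x₂ c₁, exc₁, exc₂]; field_simp; rw [hP₁, hP₂, hR₁]; ring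
  have eab₂ : a₂ - b₁ = (y₂ - z₁) * R₂ / P₂ := by
    rw [ha₂, hb₁, ← neg_sub x₁ c₂, exc₁, exc₂]; field_simp; rw [hP₁, hP₂, hR₂]; ring
  have eqr₁ : q₁ - r₂ = (x₁ - y₂) * P₁ / R₁ := by
    rw [hq₁, hr₂, ← neg_sub p₂ z₁, epz₁, epz₂]; field_simp; rw [hR₁, hR₂, hP₁]; ring
  have eqr₂ : q₂ - r₁ = (x₂ - y₁) * P₂ / R₂ := by
    rw [hq₂, hr₁, ← neg_sub p₁ z₂, epz₁, epz₂]; field_simp; rw [hR₁, hR₂, hP₂]; ring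
  refine ⟨?_, ?_, ?_⟩
  · rw [← neg_sub a₂ b₁, ← neg_sub p₂ z₁, eab₁, eab₂, epz₁, epz₂, ha₁, hp₁, ← neg_sub x₂ c₁,
      exc₁, exc₂]
    field_simp
    ring
  · rw [← neg_sub a₁ b₂, ← neg_sub q₂ r₁, eab₁, eab₂, eqr₁, eqr₂, hb₁, hq₁]
    field_simp
    ring
  · rw [← neg_sub x₁ c₂, ← neg_sub q₁ r₂, eqr₁, eqr₂, exc₁, exc₂, hc₁, hr₁, ← neg_sub p₁ z₂,
      epz₁, epz₂]
    field_simp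
    ring

/-- Y satisfies the set-theoretical Yang-Baxter equation wherever both sides are defined. -/
theorem stmt3 (x y z : ℂ × ℂ)
    (h1 : Ydom y z)
    (h2 : Ydom x (Ymap y z).2)
    (h3 : Ydom (Ymap x (Ymap y z).2).1 (Ymap y z).1)
    (h1' : Ydom x y)
    (h2' : Ydom (Ymap x y).1 z)
    (h3' : Ydom (Ymap x y).2 (Ymap (Ymap x y).1 z).2) :
    Y12 (Y13 (Y23 (x, y, z))) = Y23 (Y13 (Y12 (x, y, z))) := by
  obtain ⟨x₁, x₂⟩ := x
  obtain ⟨y₁, y₂⟩ := y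
  obtain ⟨z₁, z₂⟩ := z
  obtain ⟨e₁, e₂, e₃⟩ := yangBaxter_coordinates rfl rfl rfl rfl rfl rfl rfl rfl rfl rfl rfl rfl
    (sub_ne_zero.2 h1.1) (sub_ne_zero.2 h1.2) (sub_ne_zero.2 h2.1) (sub_ne_zero.2 h2.2)
    (sub_ne_zero.2 h1'.1) (sub_ne_zero.2 h1'.2) (sub_ne_zero.2 h2'.1) (sub_ne_zero.2 h2'.2)
  obtain ⟨f₁, f₂, f₃⟩ := yangBaxter_coordinates rfl rfl rfl rfl rfl rfl rfl rfl rfl rfl rfl rfl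
    (sub_ne_zero.2 h1.2) (sub_ne_zero.2 h1.1) (sub_ne_zero.2 h2.2) (sub_ne_zero.2 h2.1) (sub_ne_zero.2 h1'.2)
    (sub_ne_zero.2 h1'.1) (sub_ne_zero.2 h2'.2) (sub_ne_zero.2 h2'.1)
  exact Prod.ext (Prod.ext e₁ f₁) (Prod.ext (Prod.ext e₂ f₂) (Prod.ext e₃ f₃))
end

section
/- Let Y be the map defined on points (x₁,x₂,y₁,y₂) ∈ ℂ⁴ with x₁ ≠ y₂ and x₂ ≠ y₁ by Y(x₁,x₂,y₁,y₂) = (u₁,u₂,v₁,v₂) where u₁ = x₁(y₁−x₂)/(x₁−y₂), u₂ = x₂(y₂−x₁)/(x₂−y₁), v₁ = y₁(y₂−x₁)/(x₂−y₁), v₂ = y₂(y₁−x₂)/(x₁−y₂). Then Y is involutive: for every point (x₁,x₂,y₁,y₂) with x₁ ≠ y₂ and x₂ ≠ y₁ at which the image (u₁,u₂,v₁,v₂) again satisfies u₁ ≠ v₂ and u₂ ≠ v₁, one has Y(Y(x₁,x₂,y₁,y₂)) = (x₁,x₂,y₁,y₂). -/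
/-- Y is involutive: applying Y twice is the identity (wherever both
applications are defined). -/
theorem stmt4 (x₁ x₂ y₁ y₂ : ℂ)
    (hx : x₁ ≠ y₂) (hy : x₂ ≠ y₁)
    (hu : (Ymap (x₁, x₂) (y₁, y₂)).1.1 ≠ (Ymap (x₁, x₂) (y₁, y₂)).2.2)
    (hv : (Ymap (x₁, x₂) (y₁, y₂)).1.2 ≠ (Ymap (x₁, x₂) (y₁, y₂)).2.1) :
    Ymap (Ymap (x₁, x₂) (y₁, y₂)).1 (Ymap (x₁, x₂) (y₁, y₂)).2 = ((x₁, x₂), (y₁, y₂)) := by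
  have ha : x₁ - y₂ ≠ 0 := sub_ne_zero.mpr hx
  have hb : x₂ - y₁ ≠ 0 := sub_ne_zero.mpr hy
  have h₁ : x₁ * (y₁ - x₂) / (x₁ - y₂) - y₂ * (y₁ - x₂) / (x₁ - y₂) = -(x₂ - y₁) := by
    field_simp
    ring
  have h₂ : x₂ * (y₂ - x₁) / (x₂ - y₁) - y₁ * (y₂ - x₁) / (x₂ - y₁) = -(x₁ - y₂) := by
    field_simp
    ring
  have h₃ : y₁ * (y₂ - x₁) / (x₂ - y₁) - x₂ * (y₂ - x₁) / (x₂ - y₁) = x₁ - y₂ := by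
    linear_combination -h₂
  have h₄ : y₂ * (y₁ - x₂) / (x₁ - y₂) - x₁ * (y₁ - x₂) / (x₁ - y₂) = x₂ - y₁ := by
    linear_combination -h₁
  simp only [Ymap, h₁, h₂, h₃, h₄, Prod.mk.injEq]
  refine ⟨⟨?_, ?_⟩, ?_, ?_⟩ <;> field_simp <;> ring
end

section
/- Let Y be the map on ℂ⁴ given by Y(x₁,x₂,y₁,y₂) = (u₁,u₂,v₁,v₂) with u₁ = x₁(y₁−x₂)/(x₁−y₂), u₂ = x₂(y₂−x₁)/(x₂−y₁), v₁ = y₁(y₂−x₁)/(x₂−y₁), v₂ = y₂(y₁−x₂)/(x₁−y₂). Fix a, b ∈ ℂ. For all x₁, x₂ ∈ ℂ with x₁ ≠ 0, x₂ ≠ 0, x₁x₂ ≠ a, x₁x₂ ≠ b, set y₁ = a/x₁ and y₂ = b/x₂ (so that x₁y₁ = a and x₂y₂ = b). Then (i) the first two components of Y(x₁,x₂,y₁,y₂) are u₁ = x₂(a−x₁x₂)/(x₁x₂−b) and u₂ = x₁(b−x₁x₂)/(x₁x₂−a), i.e. Y restricts to the two-dimensional map Y_{a,b}(x₁,x₂)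 = (x₂(a−x₁x₂)/(−b+x₁x₂), x₁(b−x₁x₂)/(−a+x₁x₂)); and (ii) the image again lies on the leaves: u₁v₁ = a and u₂v₂ = b. -/
/-- Y restricts to the symplectic leaves x₁y₁ = a, x₂y₂ = b, where it is given
by the two-dimensional map Y_{a,b}. -/
theorem stmt7 (a b x₁ x₂ : ℂ)
    (hx₁ : x₁ ≠ 0) (hx₂ : x₂ ≠ 0) (ha : x₁ * x₂ ≠ a) (hb : x₁ * x₂ ≠ b) :
    (Ymap (x₁, x₂) (a / x₁, b / x₂)).1.1 = x₂ * (a - x₁ * x₂) / (-b + x₁ * x₂) ∧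
    (Ymap (x₁, x₂) (a / x₁, b / x₂)).1.2 = x₁ * (b - x₁ * x₂) / (-a + x₁ * x₂) ∧
    (Ymap (x₁, x₂) (a / x₁, b / x₂)).1.1 * (Ymap (x₁, x₂) (a / x₁, b / x₂)).2.1 = a ∧
    (Ymap (x₁, x₂) (a / x₁, b / x₂)).1.2 * (Ymap (x₁, x₂) (a / x₁, b / x₂)).2.2 = b := by
  have h₁ : x₁ - b / x₂ = (-b + x₁ * x₂) / x₂ := by field_simp; ring
  have h₂ : x₂ - a / x₁ = (-a + x₁ * x₂) / x₁ := by field_simp; ring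
  have h₃ : a / x₁ - x₂ = -((-a + x₁ * x₂) / x₁) := by rw [← h₂]; ring
  have h₄ : b / x₂ - x₁ = -((-b + x₁ * x₂) / x₂) := by rw [← h₁]; ring
  have ha' : -a + x₁ * x₂ ≠ 0 := fun h => ha (by linear_combination h)
  have hb' : -b + x₁ * x₂ ≠ 0 := fun h => hb (by linear_combination h)
  simp only [Ymap, h₁, h₂, h₃, h₄]
  refine ⟨?_, ?_, ?_, ?_⟩
  · field_simp
    ring
  · field_simp
    ring
  · field_simp
  · rw [mul_comm x₁ x₂] at ha' hb' ⊢
    field_simp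
end

section
/- For 𝐱 = (x₁,x₂) ∈ ℂ², a ∈ ℂ and λ ∈ ℂ, define the matrices L₁(𝐱; a)(λ) = λ·[[1,0],[0,0]] + [[a+x₁x₂, x₁],[x₂, 1]], L₂(𝐱; a)(λ) = λ·[[1,0],[0,0]] + [[x₂, x₁],[a/x₁, 0]] (requiring x₁ ≠ 0), and L₃ = L₁. Define the parametric maps on ℂ² × ℂ²: S_{a,b}((x₁,x₂),(y₁,y₂)) = ((y₁(y₁+x₁(y₂−a))/(bx₁), b/y₁), (x₁, a+x₁x₂−y₁/x₁)), R_{a,b}((x₁,x₂),(y₁,y₂)) = ((y₁ − (a−b)x₁/(1+x₁y₂), y₂), (x₁, x₂ + (a−b)y₂/(1+x₁y₂))), T_{a,b}((x₁,x₂),(y₁,y₂)) = ((a/y₂, b+y₁y₂ − a/(x₁y₂)), (x₁, (a+x₁y₂(x₂−b))/(x₁²y₂))), each defined where its denominators are nonzero. Then the system (S,R,T) satisfies the parametric entwining Yang-Baxter equation: for all parameters a, b, c and every (x,y,z) ∈ ℂ² × ℂ² × ℂ² at which all occurring denominators are nonzero, S¹²_{a,b} ∘ R¹³_{a,c} ∘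 T²³_{b,c}(x,y,z) = T²³_{b,c} ∘ R¹³_{a,c} ∘ S¹²_{a,b}(x,y,z). -/
/-- The map S_{a,b} of the NLS entwining Yang-Baxter triple. -/
noncomputable def Snls (a b : ℂ) : (ℂ × ℂ) × (ℂ × ℂ) → (ℂ × ℂ) × (ℂ × ℂ)
  | ((x₁, x₂), (y₁, y₂)) =>
    ((y₁ * (y₁ + x₁ * (y₂ - a)) / (b * x₁), b / y₁), (x₁, a + x₁ * x₂ - y₁ / x₁))

/-- The Adler-Yamilov map R_{a,b}. -/
noncomputable def Rnls (a b : ℂ) : (ℂ × ℂ) × (ℂ × ℂ) → (ℂ × ℂ) × (ℂ × ℂ)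
  | ((x₁, x₂), (y₁, y₂)) =>
    ((y₁ - (a - b) * x₁ / (1 + x₁ * y₂), y₂), (x₁, x₂ + (a - b) * y₂ / (1 + x₁ * y₂)))

/-- The map T_{a,b} of the NLS entwining Yang-Baxter triple. -/
noncomputable def Tnls (a b : ℂ) : (ℂ × ℂ) × (ℂ × ℂ) → (ℂ × ℂ) × (ℂ × ℂ)
  | ((x₁, x₂), (y₁, y₂)) =>
    ((a / y₂, b + y₁ * y₂ - a / (x₁ * y₂)), (x₁, (a + x₁ * y₂ * (x₂ - b)) / (x₁ ^ 2 * y₂)))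

/-- Nonvanishing denominators for `Snls`. -/
def SnlsDom (b : ℂ) (x y : ℂ × ℂ) : Prop := x.1 ≠ 0 ∧ y.1 ≠ 0 ∧ b ≠ 0

/-- Nonvanishing denominators for `Rnls`. -/
def RnlsDom (x y : ℂ × ℂ) : Prop := 1 + x.1 * y.2 ≠ 0

/-- Nonvanishing denominators for `Tnls`. -/
def TnlsDom (x y : ℂ × ℂ) : Prop := x.1 ≠ 0 ∧ y.2 ≠ 0

/-- The triple (S,R,T) satisfies the parametric entwining Yang-Baxter equation
wherever all occurring denominators are nonzero. -/
theorem stmt12 (a b c : ℂ) (x y z : ℂ × ℂ)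
    (h1 : TnlsDom y z)
    (h2 : RnlsDom x (Tnls b c (y, z)).2)
    (h3 : SnlsDom b (Rnls a c (x, (Tnls b c (y, z)).2)).1 (Tnls b c (y, z)).1)
    (h1' : SnlsDom b x y)
    (h2' : RnlsDom (Snls a b (x, y)).1 z)
    (h3' : TnlsDom (Snls a b (x, y)).2 (Rnls a c ((Snls a b (x, y)).1, z)).2) :
    ent12 (Snls a b) (ent13 (Rnls a c) (ent23 (Tnls b c) (x, y, z)))
      = ent23 (Tnls b c) (ent13 (Rnls a c) (ent12 (Snls a b) (x, y, z))) := by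
  obtain ⟨p, q⟩ := x
  obtain ⟨r, s⟩ := y
  obtain ⟨u, v⟩ := z
  obtain ⟨hr, hv⟩ := h1
  obtain ⟨hp, -, hb⟩ := h1'
  simp only [RnlsDom, Tnls, Snls] at h2 h2'
  dsimp only at hr hv hp
  have hD₁ : 1 + p * ((b + r * v * (s - c)) / (r ^ 2 * v))
      = (r ^ 2 * v + p * (b + r * v * (s - c))) / (r ^ 2 * v) := by
    field_simp
  have hD₂ : 1 + r * (r + p * (s - a)) / (b * p) * v
      = (b * p + r * v * (r + p * (s - a))) / (b * p) := by
    field_simp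
  have hN₁ : r ^ 2 * v + p * (b + r * v * (s - c)) ≠ 0 := by
    intro h
    exact h2 (by rw [hD₁, h, zero_div])
  have hN₂ : b * p + r * v * (r + p * (s - a)) ≠ 0 := by
    intro h
    exact h2' (by rw [hD₂, h, zero_div])
  have hX : r - (a - c) * p / (1 + p * ((b + r * v * (s - c)) / (r ^ 2 * v)))
      = r * (b * p + r * v * (r + p * (s - a))) / (r ^ 2 * v + p * (b + r * v * (s - c))) := by
    rw [hD₁]
    field_simp
    ring
  have hZ : b / r + (a - c) * v / (1 + r * (r + p * (s - a)) / (b * p) * v)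
      = b * (r ^ 2 * v + p * (b + r * v * (s - c)))
        / (r * (b * p + r * v * (r + p * (s - a)))) := by
    rw [hD₂]
    field_simp
    ring
  simp only [ent12, ent13, ent23, Snls, Rnls, Tnls, hX, hZ]
  rw [hD₁, hD₂]
  simp only [Prod.mk.injEq]
  simp only [true_and]
  clear hX hZ hD₁ hD₂ h2 h2' h3 h3'
  generalize hA : r ^ 2 * v + p * (b + r * v * (s - c)) = A at *
  generalize hB : b * p + r * v * (r + p * (s - a)) = B at *
  refine ⟨⟨?_, ?_⟩, ⟨?_, ?_⟩, ?_⟩ <;> field_simp <;> subst hA hB <;> ring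
end

section
/- For 𝐱 = (x₁,x₂) ∈ ℂ², a ∈ ℂ and λ ∈ ℂ, define L₁(𝐱; a)(λ) = λ·[[1,0],[0,0]] + [[a+x₁x₂, x₁],[x₂, 1]], L₂(𝐱; a)(λ) = λ·[[1,0],[0,0]] + [[x₂, x₁],[a/x₁, 0]] (requiring x₁ ≠ 0), and L₃ = L₁. Define the maps S_{a,b}((x₁,x₂),(y₁,y₂)) = ((u₁,u₂),(v₁,v₂)) = ((y₁(y₁+x₁(y₂−a))/(bx₁), b/y₁), (x₁, a+x₁x₂−y₁/x₁)), R_{a,b}((x₁,x₂),(y₁,y₂)) = ((y₁ − (a−b)x₁/(1+x₁y₂), y₂), (x₁, x₂ + (a−b)y₂/(1+x₁y₂))), T_{a,b}((x₁,x₂),(y₁,y₂)) = ((a/y₂, b+y₁y₂ − a/(x₁y₂)), (x₁, (a+x₁y₂(x₂−b))/(x₁²y₂))). Then (L₁,L₂,L₃) is a Lax triple for (S,R,T): for all a, b, all λ, and all points where the relevant denominators are nonzero, (i) L₁(u_s; a)(λ)·L₂(v_s; b)(λ) = L₂(y; b)(λ)·L₁(x; a)(λ) where (u_s,v_s) = S_{a,b}(x,y);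 (ii) L₁(u_r; a)(λ)·L₃(v_r; b)(λ) = L₃(y; b)(λ)·L₁(x; a)(λ) where (u_r,v_r) = R_{a,b}(x,y); (iii) L₂(u_t; a)(λ)·L₃(v_t; b)(λ) = L₃(y; b)(λ)·L₂(x; a)(λ) where (u_t,v_t) = T_{a,b}(x,y). -/
/-- Darboux matrix for NLS. -/
noncomputable def L1nls (x : ℂ × ℂ) (a lam : ℂ) : Matrix (Fin 2) (Fin 2) ℂ :=
  lam • !![(1 : ℂ), 0; 0, 0] + !![a + x.1 * x.2, x.1; x.2, 1]

/-- Degenerated Darboux matrix for NLS. -/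
noncomputable def L2nls (x : ℂ × ℂ) (a lam : ℂ) : Matrix (Fin 2) (Fin 2) ℂ :=
  lam • !![(1 : ℂ), 0; 0, 0] + !![x.2, x.1; a / x.1, 0]

/-- (L₁,L₂,L₃) with L₃ = L₁ is a Lax triple for the NLS entwining Yang-Baxter
maps (S,R,T): each map satisfies its refactorisation identity wherever the
relevant denominators are nonzero. -/
theorem stmt13 (a b lam x₁ x₂ y₁ y₂ : ℂ) :
    (x₁ ≠ 0 → y₁ ≠ 0 → b ≠ 0 →
      L1nls (y₁ * (y₁ + x₁ * (y₂ - a)) / (b * x₁), b / y₁) a lam *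
          L2nls (x₁, a + x₁ * x₂ - y₁ / x₁) b lam
        = L2nls (y₁, y₂) b lam * L1nls (x₁, x₂) a lam) ∧
    (1 + x₁ * y₂ ≠ 0 →
      L1nls (y₁ - (a - b) * x₁ / (1 + x₁ * y₂), y₂) a lam *
          L1nls (x₁, x₂ + (a - b) * y₂ / (1 + x₁ * y₂)) b lam
        = L1nls (y₁, y₂) b lam * L1nls (x₁, x₂) a lam) ∧
    (x₁ ≠ 0 → y₂ ≠ 0 → a ≠ 0 →
      L2nls (a / y₂, b + y₁ * y₂ - a / (x₁ * y₂)) a lam *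
          L1nls (x₁, (a + x₁ * y₂ * (x₂ - b)) / (x₁ ^ 2 * y₂)) b lam
        = L1nls (y₁, y₂) b lam * L2nls (x₁, x₂) a lam) := by
  have smul_add_of (l p q r s : ℂ) :
      l • !![(1 : ℂ), 0; 0, 0] + !![p, q; r, s] = !![l + p, q; r, s] := by
    ext i j
    fin_cases i <;> fin_cases j <;> simp
  have of_inj {p q r s p' q' r' s' : ℂ} (hp : p = p') (hq : q = q') (hr : r = r') (hs : s = s') :
      !![p, q; r, s] = !![p', q'; r', s'] := by
    rw [hp, hq, hr, hs]
  simp only [L1nls, L2nls, smul_add_of, Matrix.mul_fin_two]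
  refine ⟨fun hx hy hb => ?_, fun h => ?_, fun hx hy ha => ?_⟩
  · apply of_inj <;> field_simp <;> ring
  · have h' : 1 + y₂ * x₁ ≠ 0 := by rwa [mul_comm y₂]
    apply of_inj <;> field_simp <;> ring
  · apply of_inj <;> field_simp <;> ring
end

section
/- Let S_{a,b} be the map on ℂ² × ℂ² given by S_{a,b}((x₁,x₂),(y₁,y₂)) = ((u₁,u₂),(v₁,v₂)) with u₁ = y₁(y₁+x₁(y₂−a))/(bx₁), u₂ = b/y₁, v₁ = x₁, v₂ = a+x₁x₂−y₁/x₁, defined for x₁ ≠ 0, y₁ ≠ 0, b ≠ 0. Then the functions I₁ = x₁x₂ + y₂ and I₂ = x₁x₂y₂ + x₂y₁ + a·y₂ + b·x₁/y₁ are invariants of S_{a,b}: at every point of the domain (with u₁ ≠ 0), u₁u₂ + v₂ = x₁x₂ + y₂ and u₁u₂v₂ + u₂v₁ + a·v₂ + b·u₁/v₁ = x₁x₂y₂ + x₂y₁ + a·y₂ + b·x₁/y₁. -/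
/-- I₁ = x₁x₂ + y₂ and I₂ = x₁x₂y₂ + x₂y₁ + a y₂ + b x₁/y₁ are invariants of
the map S_{a,b} of the NLS entwining triple, where
(u₁,u₂,v₁,v₂) = (y₁(y₁+x₁(y₂−a))/(bx₁), b/y₁, x₁, a+x₁x₂−y₁/x₁). -/
theorem stmt15 (a b x₁ x₂ y₁ y₂ : ℂ)
    (hx : x₁ ≠ 0) (hy : y₁ ≠ 0) (hb : b ≠ 0)
    (hu : y₁ * (y₁ + x₁ * (y₂ - a)) / (b * x₁) ≠ 0) :
    (y₁ * (y₁ + x₁ * (y₂ - a)) / (b * x₁)) * (b / y₁) + (a + x₁ * x₂ - y₁ / x₁)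
      = x₁ * x₂ + y₂ ∧
    (y₁ * (y₁ + x₁ * (y₂ - a)) / (b * x₁)) * (b / y₁) * (a + x₁ * x₂ - y₁ / x₁)
        + (b / y₁) * x₁ + a * (a + x₁ * x₂ - y₁ / x₁)
        + b * (y₁ * (y₁ + x₁ * (y₂ - a)) / (b * x₁)) / x₁
      = x₁ * x₂ * y₂ + x₂ * y₁ + a * y₂ + b * x₁ / y₁ := by
  constructor <;> field_simp <;> ring
end

section
/- Consider on the open subset of ℂ⁴ where y₁ ≠ 0, with coordinates (x₁,x₂,y₁,y₂), the Poisson bracket determined on coordinates by {x₁,x₂} = 1, {y₁,y₂} = y₁, and {x_i, y_j} = 0 for all i, j. Then the functions I₁ = x₁x₂ + y₂ and I₂ = x₁x₂y₂ + x₂y₁ + a·y₂ + b·x₁/y₁ (for any fixed a, b ∈ ℂ) are in involution: the expression {I₁,I₂} = (∂I₁/∂x₁ · ∂I₂/∂x₂ − ∂I₁/∂x₂ · ∂I₂/∂x₁) + y₁·(∂I₁/∂y₁ · ∂I₂/∂y₂ − ∂I₁/∂y₂ · ∂I₂/∂y₁) vanishes identically on {y₁ ≠ 0}. -/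
/-- Partial derivative of F(x₁,x₂,y₁,y₂) with respect to the first coordinate. -/
noncomputable def pd1 (F : ℂ → ℂ → ℂ → ℂ → ℂ) (x₁ x₂ y₁ y₂ : ℂ) : ℂ :=
  deriv (fun t => F t x₂ y₁ y₂) x₁

/-- Partial derivative with respect to the second coordinate. -/
noncomputable def pd2 (F : ℂ → ℂ → ℂ → ℂ → ℂ) (x₁ x₂ y₁ y₂ : ℂ) : ℂ :=
  deriv (fun t => F x₁ t y₁ y₂) x₂

/-- Partial derivative with respect to the third coordinate. -/
noncomputable def pd3 (F : ℂ → ℂ → ℂ → ℂ → ℂ) (x₁ x₂ y₁ y₂ : ℂ) : ℂ :=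
  deriv (fun t => F x₁ x₂ t y₂) y₁

/-- Partial derivative with respect to the fourth coordinate. -/
noncomputable def pd4 (F : ℂ → ℂ → ℂ → ℂ → ℂ) (x₁ x₂ y₁ y₂ : ℂ) : ℂ :=
  deriv (fun t => F x₁ x₂ y₁ t) y₂

/-- The invariant I₁ = x₁x₂ + y₂. -/
def Inls1 : ℂ → ℂ → ℂ → ℂ → ℂ := fun x₁ x₂ _ y₂ => x₁ * x₂ + y₂

/-- The invariant I₂ = x₁x₂y₂ + x₂y₁ + a y₂ + b x₁/y₁. -/
noncomputable def Inls2 (a b : ℂ) : ℂ → ℂ → ℂ → ℂ → ℂ :=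
  fun x₁ x₂ y₁ y₂ => x₁ * x₂ * y₂ + x₂ * y₁ + a * y₂ + b * x₁ / y₁

theorem pd1_Inls1 (x₁ x₂ y₁ y₂ : ℂ) : pd1 Inls1 x₁ x₂ y₁ y₂ = x₂ := by
  simp [pd1, Inls1]

theorem pd2_Inls1 (x₁ x₂ y₁ y₂ : ℂ) : pd2 Inls1 x₁ x₂ y₁ y₂ = x₁ := by
  simp [pd2, Inls1]

theorem pd3_Inls1 (x₁ x₂ y₁ y₂ : ℂ) : pd3 Inls1 x₁ x₂ y₁ y₂ = 0 := by
  simp [pd3, Inls1]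

theorem pd4_Inls1 (x₁ x₂ y₁ y₂ : ℂ) : pd4 Inls1 x₁ x₂ y₁ y₂ = 1 := by
  simp [pd4, Inls1]

theorem pd1_Inls2 (a b x₁ x₂ y₁ y₂ : ℂ) :
    pd1 (Inls2 a b) x₁ x₂ y₁ y₂ = x₂ * y₂ + b / y₁ := by
  have h := (((((hasDerivAt_id x₁).mul_const x₂).mul_const y₂).add_const (x₂ * y₁)).add_const
    (a * y₂)).add (((hasDerivAt_id x₁).const_mul b).div_const y₁)
  exact h.deriv.trans (by ring)

theorem pd2_Inls2 (a b x₁ x₂ y₁ y₂ : ℂ) :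
    pd2 (Inls2 a b) x₁ x₂ y₁ y₂ = x₁ * y₂ + y₁ := by
  have h := (((((hasDerivAt_id x₂).const_mul x₁).mul_const y₂).add
    ((hasDerivAt_id x₂).mul_const y₁)).add_const (a * y₂)).add_const (b * x₁ / y₁)
  exact h.deriv.trans (by ring)

theorem pd3_Inls2 (a b x₁ x₂ : ℂ) {y₁ : ℂ} (y₂ : ℂ) (hy : y₁ ≠ 0) :
    pd3 (Inls2 a b) x₁ x₂ y₁ y₂ = x₂ - b * x₁ / y₁ ^ 2 := by
  have h := ((((hasDerivAt_id y₁).const_mul x₂).const_add (x₁ * x₂ * y₂)).add_const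
    (a * y₂)).add ((hasDerivAt_const y₁ (b * x₁)).div (hasDerivAt_id y₁) hy)
  exact h.deriv.trans (by simp only [id]; ring)

/-- I₁ and I₂ are in involution with respect to the Poisson bracket with
coordinate brackets {x₁,x₂} = 1, {y₁,y₂} = y₁, {x_i,y_j} = 0, on {y₁ ≠ 0}. -/
theorem stmt16 (a b : ℂ) :
    ∀ x₁ x₂ y₁ y₂ : ℂ, y₁ ≠ 0 →
      (pd1 Inls1 x₁ x₂ y₁ y₂ * pd2 (Inls2 a b) x₁ x₂ y₁ y₂
          - pd2 Inls1 x₁ x₂ y₁ y₂ * pd1 (Inls2 a b) x₁ x₂ y₁ y₂)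
        + y₁ * (pd3 Inls1 x₁ x₂ y₁ y₂ * pd4 (Inls2 a b) x₁ x₂ y₁ y₂
          - pd4 Inls1 x₁ x₂ y₁ y₂ * pd3 (Inls2 a b) x₁ x₂ y₁ y₂) = 0 := by
  intro x₁ x₂ y₁ y₂ hy
  rw [pd1_Inls1, pd2_Inls1, pd3_Inls1, pd4_Inls1, pd1_Inls2, pd2_Inls2, pd3_Inls2 a b x₁ x₂ y₂ hy]
  field_simp
  ring
end

section
/- Let T_{a,b} be the map on ℂ² × ℂ² given by T_{a,b}((x₁,x₂),(y₁,y₂)) = ((u₁,u₂),(v₁,v₂)) with u₁ = a/y₂, u₂ = b + y₁y₂ − a/(x₁y₂), v₁ = x₁, v₂ = (a + x₁y₂(x₂−b))/(x₁²y₂), defined for x₁ ≠ 0 and y₂ ≠ 0. Then the functions I₁ = x₂ + y₁y₂ and I₂ = x₂y₁y₂ + x₁y₂ + b·x₂ + a·y₁/x₁ are invariants of T_{a,b}: at every point of the domain, u₂ + v₁v₂ = x₂ + y₁y₂ and u₂v₁v₂ + u₁v₂ + b·u₂ + a·v₁/u₁ = x₂y₁y₂ + x₁y₂ + b·x₂ +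 a·y₁/x₁ (the last requiring also a ≠ 0 so that u₁ ≠ 0). -/
/-- I₁ = x₂ + y₁y₂ and I₂ = x₂y₁y₂ + x₁y₂ + b x₂ + a y₁/x₁ are invariants of
the map T_{a,b} of the NLS entwining triple, where
(u₁,u₂,v₁,v₂) = (a/y₂, b+y₁y₂−a/(x₁y₂), x₁, (a+x₁y₂(x₂−b))/(x₁²y₂)). -/
theorem stmt17 (a b x₁ x₂ y₁ y₂ : ℂ) (hx : x₁ ≠ 0) (hy : y₂ ≠ 0) :
    (b + y₁ * y₂ - a / (x₁ * y₂)) + x₁ * ((a + x₁ * y₂ * (x₂ - b)) / (x₁ ^ 2 * y₂))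
      = x₂ + y₁ * y₂ ∧
    (a ≠ 0 →
      (b + y₁ * y₂ - a / (x₁ * y₂)) * x₁ * ((a + x₁ * y₂ * (x₂ - b)) / (x₁ ^ 2 * y₂))
          + (a / y₂) * ((a + x₁ * y₂ * (x₂ - b)) / (x₁ ^ 2 * y₂))
          + b * (b + y₁ * y₂ - a / (x₁ * y₂))
          + a * x₁ / (a / y₂)
        = x₂ * y₁ * y₂ + x₁ * y₂ + b * x₂ + a * y₁ / x₁) := by
  constructor
  · field_simp
    ring
  · intro ha
    field_simp
    ring
end

section
/- Define the parametric maps on ℂ² × ℂ²: S_{a,b}((x₁,x₂),(y₁,y₂)) = (( y₂(x₁y₁ − a(x₁+y₂))/(bx₁), bx₁/(y₂(x₁+y₂)) ), ( (x₁+y₂)(a+x₁x₂)/x₁, x₁+y₂ )), R_{a,b}((x₁,x₂),(y₁,y₂)) = (( y₁ + (a−b)x₁/(a−x₁y₂), y₂(a−x₁y₂)/(b−x₁y₂) ), ( x₁(b−x₁y₂)/(a−x₁y₂), x₂ + (b−a)y₂/(b−x₁y₂) )), T_{a,b}((x₁,x₂),(y₁,y₂)) = (( (a+x₂y₂)(b+y₁y₂)/(x₂y₂),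 ax₂/(a+x₂y₂) ), ( x₂²y₂/(a+x₂y₂), (x₁x₂y₂ − b(a+x₂y₂))/(x₂²y₂) )), each defined where its denominators are nonzero. Then the system (S,R,T) satisfies the parametric entwining Yang-Baxter equation: for all parameters a, b, c and every (x,y,z) ∈ ℂ² × ℂ² × ℂ² at which all denominators occurring in both compositions are nonzero, S¹²_{a,b} ∘ R¹³_{a,c} ∘ T²³_{b,c}(x,y,z) = T²³_{b,c} ∘ R¹³_{a,c} ∘ S¹²_{a,b}(x,y,z). -/
/-- The map S_{a,b} of the DNLS (degenerate orbits) entwining Yang-Baxter triple. -/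
noncomputable def Sd (a b : ℂ) : (ℂ × ℂ) × (ℂ × ℂ) → (ℂ × ℂ) × (ℂ × ℂ)
  | ((x₁, x₂), (y₁, y₂)) =>
    ((y₂ * (x₁ * y₁ - a * (x₁ + y₂)) / (b * x₁), b * x₁ / (y₂ * (x₁ + y₂))),
     ((x₁ + y₂) * (a + x₁ * x₂) / x₁, x₁ + y₂))

/-- The map R_{a,b} of the DNLS (degenerate orbits) entwining Yang-Baxter triple. -/
noncomputable def Rd (a b : ℂ) : (ℂ × ℂ) × (ℂ × ℂ) → (ℂ × ℂ) × (ℂ × ℂ)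
  | ((x₁, x₂), (y₁, y₂)) =>
    ((y₁ + (a - b) * x₁ / (a - x₁ * y₂), y₂ * (a - x₁ * y₂) / (b - x₁ * y₂)),
     (x₁ * (b - x₁ * y₂) / (a - x₁ * y₂), x₂ + (b - a) * y₂ / (b - x₁ * y₂)))

/-- The map T_{a,b} of the DNLS (degenerate orbits) entwining Yang-Baxter triple. -/
noncomputable def Td (a b : ℂ) : (ℂ × ℂ) × (ℂ × ℂ) → (ℂ × ℂ) × (ℂ × ℂ)
  | ((x₁, x₂), (y₁, y₂)) =>
    (((a + x₂ * y₂) * (b + y₁ * y₂) / (x₂ * y₂), a * x₂ / (a + x₂ * y₂)),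
     (x₂ ^ 2 * y₂ / (a + x₂ * y₂), (x₁ * x₂ * y₂ - b * (a + x₂ * y₂)) / (x₂ ^ 2 * y₂)))

/-- Nonvanishing denominators for `Sd`. -/
def SdDom (b : ℂ) (x y : ℂ × ℂ) : Prop :=
  x.1 ≠ 0 ∧ b ≠ 0 ∧ y.2 ≠ 0 ∧ x.1 + y.2 ≠ 0

/-- Nonvanishing denominators for `Rd`. -/
def RdDom (a b : ℂ) (x y : ℂ × ℂ) : Prop :=
  a - x.1 * y.2 ≠ 0 ∧ b - x.1 * y.2 ≠ 0

/-- Nonvanishing denominators for `Td`. -/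
def TdDom (a : ℂ) (x y : ℂ × ℂ) : Prop :=
  x.2 ≠ 0 ∧ y.2 ≠ 0 ∧ a + x.2 * y.2 ≠ 0

/-- The triple (S,R,T) satisfies the parametric entwining Yang-Baxter equation
wherever all occurring denominators are nonzero. -/
theorem stmt18 (a b c : ℂ) (x y z : ℂ × ℂ)
    (h1 : TdDom b y z)
    (h2 : RdDom a c x (Td b c (y, z)).2)
    (h3 : SdDom b (Rd a c (x, (Td b c (y, z)).2)).1 (Td b c (y, z)).1)
    (h1' : SdDom b x y)
    (h2' : RdDom a c (Sd a b (x, y)).1 z)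
    (h3' : TdDom b (Sd a b (x, y)).2 (Rd a c ((Sd a b (x, y)).1, z)).2) :
    ent12 (Sd a b) (ent13 (Rd a c) (ent23 (Td b c) (x, y, z)))
      = ent23 (Td b c) (ent13 (Rd a c) (ent12 (Sd a b) (x, y, z))) := by
  obtain ⟨p, q⟩ := x
  obtain ⟨r, s⟩ := y
  obtain ⟨u, v⟩ := z
  simp only [SdDom, RdDom, TdDom, Sd, Td] at h1 h2 h1' h2'
  obtain ⟨hs, hv, hd⟩ := h1
  obtain ⟨hp, hb, -, hps⟩ := h1'
  obtain ⟨d, d_def⟩ : ∃ d, d = b + s * v := ⟨_, rfl⟩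
  obtain ⟨e₁, e₁_def⟩ : ∃ e, e = a * s ^ 2 * v - p * (r * s * v - c * d) := ⟨_, rfl⟩
  obtain ⟨e₂, e₂_def⟩ : ∃ e, e = c * s ^ 2 * v - p * (r * s * v - c * d) := ⟨_, rfl⟩
  obtain ⟨f₁, f₁_def⟩ : ∃ f, f = a * b * p - s * v * (p * r - a * (p + s)) := ⟨_, rfl⟩
  obtain ⟨f₂, f₂_def⟩ : ∃ f, f = c * b * p - s * v * (p * r - a * (p + s)) := ⟨_, rfl⟩
  obtain ⟨m, m_def⟩ : ∃ m, m = p + s := ⟨_, rfl⟩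
  rw [← d_def] at hd h2
  rw [← m_def] at hps h2'
  have a_sub_left : a - p * ((r * s * v - c * d) / (s ^ 2 * v)) = e₁ / (s ^ 2 * v) := by
    rw [e₁_def]; field_simp
  have c_sub_left : c - p * ((r * s * v - c * d) / (s ^ 2 * v)) = e₂ / (s ^ 2 * v) := by
    rw [e₂_def]; field_simp
  have a_sub_right : a - s * (p * r - a * m) / (b * p) * v = f₁ / (b * p) := by
    rw [f₁_def, m_def]; field_simp
  have c_sub_right : c - s * (p * r - a * m) / (b * p) * v = f₂ / (b * p) := by
    rw [f₂_def, m_def]; field_simp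
  rw [a_sub_left, c_sub_left] at h2
  rw [a_sub_right, c_sub_right] at h2'
  have he₁ : e₁ ≠ 0 := (div_ne_zero_iff.mp h2.1).1
  have he₂ : e₂ ≠ 0 := (div_ne_zero_iff.mp h2.2).1
  have hf₁ : f₁ ≠ 0 := (div_ne_zero_iff.mp h2'.1).1
  have hf₂ : f₂ ≠ 0 := (div_ne_zero_iff.mp h2'.2).1
  have left_fst : s ^ 2 * v / d + (a - c) * p / (e₁ / (s ^ 2 * v)) = s ^ 2 * v * f₁ / (d * e₁) := by
    field_simp
    rw [e₁_def, f₁_def, d_def]; ring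
  have left_sum : s ^ 2 * v * f₁ / (d * e₁) + b * s / d = s * f₂ / e₁ := by
    field_simp
    rw [e₁_def, f₁_def, f₂_def, d_def]; ring
  have right_snd : b * p / (s * m) + (c - a) * v / (f₂ / (b * p)) = b * p * e₂ / (s * m * f₂) := by
    field_simp
    rw [e₂_def, f₂_def, d_def, m_def]; ring
  have right_sum : b + m * (b * p * e₂ / (s * m * f₂)) = b * m * e₁ / (s * f₂) := by
    field_simp
    rw [e₁_def, e₂_def, f₂_def, d_def, m_def]; ring
  simp only [ent12, ent13, ent23, Sd, Rd, Td, ← d_def, ← m_def, a_sub_left, c_sub_left,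
    a_sub_right, c_sub_right, left_fst, left_sum, right_snd, right_sum, Prod.mk.injEq]
  refine ⟨⟨?_, ?_⟩, ⟨?_, ?_⟩, ?_, ?_⟩
  · field_simp
    rw [f₁_def, f₂_def, m_def]; ring
  · field_simp
  · field_simp
    rw [e₁_def, e₂_def, f₁_def, f₂_def, d_def, m_def]; ring
  · field_simp
  · field_simp
  · field_simp
    rw [e₁_def, e₂_def]; ring
end

section
/- Let S_{a,b} be the map on ℂ² × ℂ² given by S_{a,b}((x₁,x₂),(y₁,y₂)) = ((u₁,u₂),(v₁,v₂)) with u₁ = y₂(x₁y₁ − a(x₁+y₂))/(bx₁), u₂ = bx₁/(y₂(x₁+y₂)), v₁ = (x₁+y₂)(a+x₁x₂)/x₁, v₂ = x₁+y₂, defined for x₁ ≠ 0, y₂ ≠ 0, b ≠ 0, x₁+y₂ ≠ 0. Then the functions I₁ = y₁(x₁x₂ + a) and I₂ = x₁x₂ + y₁ + x₂y₂ + b·x₁/y₂ are invariants of S_{a,b}: at every point of the domain, v₁(u₁u₂ + a) = y₁(x₁x₂ + a) and u₁u₂ + v₁ + u₂v₂ + b·u₁/v₂ = x₁x₂ + y₁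 + x₂y₂ + b·x₁/y₂. -/
/-- I₁ = y₁(x₁x₂ + a) and I₂ = x₁x₂ + y₁ + x₂y₂ + b x₁/y₂ are invariants of the
map S_{a,b} of the DNLS (degenerate orbits) entwining triple, where
u₁ = y₂(x₁y₁ − a(x₁+y₂))/(bx₁), u₂ = bx₁/(y₂(x₁+y₂)),
v₁ = (x₁+y₂)(a+x₁x₂)/x₁, v₂ = x₁+y₂. -/
theorem stmt19 (a b x₁ x₂ y₁ y₂ : ℂ)
    (hx : x₁ ≠ 0) (hy : y₂ ≠ 0) (hb : b ≠ 0) (hs : x₁ + y₂ ≠ 0) :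
    ((x₁ + y₂) * (a + x₁ * x₂) / x₁) *
        ((y₂ * (x₁ * y₁ - a * (x₁ + y₂)) / (b * x₁)) * (b * x₁ / (y₂ * (x₁ + y₂))) + a)
      = y₁ * (x₁ * x₂ + a) ∧
    (y₂ * (x₁ * y₁ - a * (x₁ + y₂)) / (b * x₁)) * (b * x₁ / (y₂ * (x₁ + y₂)))
        + (x₁ + y₂) * (a + x₁ * x₂) / x₁
        + (b * x₁ / (y₂ * (x₁ + y₂))) * (x₁ + y₂)
        + b * (y₂ * (x₁ * y₁ - a * (x₁ + y₂)) / (b * x₁)) / (x₁ + y₂)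
      = x₁ * x₂ + y₁ + x₂ * y₂ + b * x₁ / y₂ := by
  constructor <;> field_simp <;> ring
end
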